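/- Let ε > 0 with 5ε ≤ 1, and let (G, w) be an ε-coherent weighted graph, where G is hole-with-hat-free. Let F be a forcer in G. Then there is a split (C, D) of (G, w) such that each of G[C] and G[D] contains a constituent path of F. -/

import Mathlib

open Finset

namespace EHhat

variable {V : Type*}

/-- `c : ZMod n → V` describes a hole (induced cycle of length `n ≥ 4`) in `G`. -/
def IsHole (G : SimpleGraph V) (n : ℕ) (c : ZMod n → V) : Prop :=
  4 ≤ n ∧ Function.Injective c ∧
    ∀ i j : ZMod n, G.Adj (c i) (c j) ↔ (i - j = 1 ∨ j - i = 1)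

/-- `G` contains a hole together with a hat: a vertex outside the hole with exactly
two neighbours on the hole, and these two neighbours are adjacent (consecutive). -/
def HasHoleWithHat (G : SimpleGraph V) : Prop :=
  ∃ (n : ℕ) (c : ZMod n → V) (v : V) (i : ZMod n),
    IsHole G n c ∧ (∀ j, v ≠ c j) ∧ (∀ j, G.Adj v (c j) ↔ (j = i ∨ j = i + 1))

def HoleWithHatFree (G : SimpleGraph V) : Prop := ¬ HasHoleWithHat G

/-- A graph is perfect if chromatic number equals clique number for
every induced subgraph. -/
def IsPerfect [Fintype V] (G : SimpleGraph V) : Prop :=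
  ∀ S : Finset V,
    (G.induce (S : Set V)).chromaticNumber = ((G.induce (S : Set V)).cliqueNum : ℕ∞)

/-- `f` is a good function on `G`: it is nonnegative and sums to at most 1 on
every perfect induced subgraph of `G`. -/
def GoodOn [Fintype V] (G : SimpleGraph V) (f : V → ℝ) : Prop :=
  (∀ v, 0 ≤ f v) ∧
  ∀ S : Finset V, IsPerfect (G.induce (S : Set V)) → ∑ v ∈ S, f v ≤ 1

/-- `G` is `α`-narrow if `∑ v, f v ^ α ≤ 1` for every good function `f` on `G`. -/
def Narrow [Fintype V] (G : SimpleGraph V) (α : ℝ) : Prop :=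
  ∀ f : V → ℝ, GoodOn G f → ∑ v, f v ^ α ≤ 1

/-- `(G, f)` is an `α`-critical pair. -/
def Critical [Fintype V] (G : SimpleGraph V) (f : V → ℝ) (α : ℝ) : Prop :=
  GoodOn G f ∧
  (∀ S : Finset V, S ≠ Finset.univ → Narrow (G.induce (S : Set V)) α) ∧
  1 < ∑ v, f v ^ α

/-- `A` is complete to `B`. -/
def CompleteTo (G : SimpleGraph V) (A B : Set V) : Prop :=
  ∀ a ∈ A, ∀ b ∈ B, G.Adj a b

/-- `A` is anticomplete to `B`. -/
def AnticompleteTo (G : SimpleGraph V) (A B : Set V) : Prop :=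
  ∀ a ∈ A, ∀ b ∈ B, ¬ G.Adj a b

/-- The vertex `v` is complete to the set `C`. -/
def VertCompleteTo (G : SimpleGraph V) (v : V) (C : Set V) : Prop :=
  ∀ c ∈ C, G.Adj v c

/-- The vertex `v` is mixed on `C`: it has both a neighbour and a non-neighbour in `C`. -/
def MixedOn (G : SimpleGraph V) (v : V) (C : Set V) : Prop :=
  (∃ c ∈ C, G.Adj v c) ∧ (∃ c ∈ C, ¬ G.Adj v c)

/-- `X ⊆ V(G)` is connected: `G[X]` is a connected graph. -/
def ConnSet (G : SimpleGraph V) (X : Set V) : Prop :=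
  (G.induce X).Connected

/-- `X ⊆ V(G)` is anticonnected: the complement of `G[X]` is a connected graph. -/
def AnticonnSet (G : SimpleGraph V) (X : Set V) : Prop :=
  ((G.induce X)ᶜ).Connected

/-- The sum of `f` over a set `X` of vertices. -/
noncomputable def setSum [Fintype V] (f : V → ℝ) (X : Set V) : ℝ :=
  ∑ v, X.indicator f v

/-- `w` is a weight function making `(G, w)` a weighted graph. -/
def IsWeight [Fintype V] (w : V → ℝ) : Prop :=
  (∀ v, 0 ≤ w v) ∧ ∑ v, w v = 1

/-- The weighted graph `(G, w)` is `ε`-coherent. -/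
def Coherent [Fintype V] (G : SimpleGraph V) (w : V → ℝ) (ε : ℝ) : Prop :=
  (∀ v, w v < ε) ∧
  (∀ v, setSum w (G.neighborSet v) < ε) ∧
  ∀ A B : Set V, Disjoint A B → AnticompleteTo G A B →
    min (setSum w A) (setSum w B) < ε

/-- `Y` is (the vertex set of) a component of `G[X]`: a maximal connected subset of `X`. -/
def IsCompOf (G : SimpleGraph V) (X Y : Set V) : Prop :=
  Y ⊆ X ∧ ConnSet G Y ∧
  ∀ Z : Set V, Y ⊆ Z → Z ⊆ X → ConnSet G Z → Z = Y

/-- `Y` is the big component of `G[X]` (with respect to the weight `w` and `ε`). -/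
def IsBigComp [Fintype V] (G : SimpleGraph V) (w : V → ℝ) (ε : ℝ) (X Y : Set V) : Prop :=
  IsCompOf G X Y ∧ setSum w X - ε < setSum w Y

/-- `v` is an attachment of `A`: a vertex outside `A` with a neighbour in `A`. -/
def IsAttachment (G : SimpleGraph V) (A : Set V) (v : V) : Prop :=
  v ∉ A ∧ ∃ a ∈ A, G.Adj v a

/-- `(C, D)` is a split of the weighted graph `(G, w)`. -/
def IsSplit [Fintype V] (G : SimpleGraph V) (w : V → ℝ) (ε : ℝ) (C D : Set V) : Prop :=
  Disjoint C D ∧ 2 ≤ C.ncard ∧ ConnSet G C ∧ AnticonnSet G C ∧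
  D.Nonempty ∧ D = {v | v ∉ C ∧ ∀ c ∈ C, G.Adj v c} ∧
  ∀ Y : Set V, IsBigComp G w ε ((C ∪ D)ᶜ) Y → ∀ c ∈ C, ¬ IsAttachment G Y c

/-- A split is optimal if its first part is maximal among splits. -/
def IsOptimalSplit [Fintype V] (G : SimpleGraph V) (w : V → ℝ) (ε : ℝ) (C D : Set V) : Prop :=
  IsSplit G w ε C D ∧ ∀ C' D' : Set V, IsSplit G w ε C' D' → C ⊆ C' → C' = C

/-- `(A, C, D, B)` is a fracture of `(G, w)`: `(C, D)` is an optimal split, `A` is the union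
of the components of `G \ (C ∪ D)` with an attachment in `C`, and `B` is the rest. -/
def IsFracture [Fintype V] (G : SimpleGraph V) (w : V → ℝ) (ε : ℝ)
    (A C D B : Set V) : Prop :=
  IsOptimalSplit G w ε C D ∧
  A = {v | ∃ Y : Set V, IsCompOf G ((C ∪ D)ᶜ) Y ∧ v ∈ Y ∧ ∃ c ∈ C, IsAttachment G Y c} ∧
  B = ((C ∪ D)ᶜ : Set V) \ A

/-- The generating relation for the forcer graph: vertices `0,1,2,3` and `4,5,6,7`
each induce a path, and the two quadruples are complete to each other. -/
def forcerRel (i j : Fin 8) : Prop :=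
  (i.val < 4 ∧ 4 ≤ j.val) ∨ j.val = i.val + 1

/-- The forcer graph. -/
def forcer : SimpleGraph (Fin 8) := SimpleGraph.fromRel forcerRel

def ForcerFree (G : SimpleGraph V) : Prop := IsEmpty (forcer ↪g G)

/-- Given an embedded copy of the forcer via the vertex map `f`, one of its two
constituent paths has all its vertices in `S`. -/
def ConstituentPathIn (f : Fin 8 → V) (S : Set V) : Prop :=
  (∀ i : Fin 8, i.val < 4 → f i ∈ S) ∨ (∀ i : Fin 8, 4 ≤ i.val → f i ∈ S)

/-- `X` is a homogeneous set of `H`. -/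
def IsHomogeneousSet {W : Type*} (H : SimpleGraph W) (X : Set W) : Prop :=
  ∀ v ∉ X, (∀ x ∈ X, H.Adj v x) ∨ (∀ x ∈ X, ¬ H.Adj v x)

/-- `H` is guarded: for each forcer in `H` there is a proper homogeneous set
containing a constituent path of the forcer. -/
def Guarded {W : Type*} (H : SimpleGraph W) : Prop :=
  ∀ f : forcer ↪g H, ∃ X : Set W,
    X ≠ Set.univ ∧ IsHomogeneousSet H X ∧ ConstituentPathIn (fun i => f i) X

/-- The house: the complement of the five-vertex path. -/
def house : SimpleGraph (Fin 5) := (SimpleGraph.pathGraph 5)ᶜ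

def HouseFree (G : SimpleGraph V) : Prop := IsEmpty (house ↪g G)

/-- `g` is a good function on the induced subgraph `G[X]`. -/
def GoodOnSub [Fintype V] (G : SimpleGraph V) (X : Set V) (g : V → ℝ) : Prop :=
  (∀ v ∈ X, 0 ≤ g v) ∧
  ∀ S : Finset V, (S : Set V) ⊆ X → IsPerfect (G.induce (S : Set V)) →
    ∑ v ∈ S, g v ≤ 1


/-- A cycle listed by a function on `ℕ`, with a hat at its first two vertices. -/
theorem hasHoleWithHat_of_nat {G : SimpleGraph V} {n : ℕ} (hn : 4 ≤ n) (g : ℕ → V) (v : V)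
    (hinj : ∀ a b, a < b → b < n → g a ≠ g b)
    (hadj : ∀ a b, a < b → b < n → (G.Adj (g a) (g b) ↔ (b = a + 1 ∨ (a = 0 ∧ b + 1 = n))))
    (hv : ∀ a, a < n → v ≠ g a) (hvadj : ∀ a, a < n → (G.Adj v (g a) ↔ (a = 0 ∨ a = 1))) :
    HasHoleWithHat G := by
  obtain ⟨m, rfl⟩ : ∃ m, n = m + 1 := ⟨n - 1, by omega⟩
  have hsucc : ∀ i j : ZMod (m + 1), i - j = 1 ↔
      (i.val = j.val + 1 ∨ (i.val = 0 ∧ j.val = m)) := by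
    intro i j
    have hi := ZMod.val_lt i
    have hj := ZMod.val_lt j
    have h1 : (1 : ZMod (m + 1)).val = 1 := by
      rw [ZMod.val_one_eq_one_mod]; exact Nat.mod_eq_of_lt (by omega)
    rw [sub_eq_iff_eq_add, ← (ZMod.val_injective (m + 1)).eq_iff, ZMod.val_add, h1]
    rcases Nat.lt_or_ge (1 + j.val) (m + 1) with h | h
    · rw [Nat.mod_eq_of_lt h]; omega
    · have : 1 + j.val = m + 1 := by omega
      rw [this, Nat.mod_self]; omega
  have hadj' : ∀ a b : ℕ, a < b → b < m + 1 →
      (G.Adj (g a) (g b) ↔ (b = a + 1 ∨ (a = 0 ∧ b = m))) := by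
    intro a b hab hb
    rw [hadj a b hab hb]; omega
  refine ⟨m + 1, fun i => g i.val, v, 0, ⟨hn, ?_, ?_⟩, fun j => hv _ (ZMod.val_lt j), ?_⟩
  · intro i j hij
    apply ZMod.val_injective
    rcases lt_trichotomy i.val j.val with h | h | h
    · exact absurd hij (hinj _ _ h (ZMod.val_lt j))
    · exact h
    · exact absurd hij.symm (hinj _ _ h (ZMod.val_lt i))
  · intro i j
    have hi := ZMod.val_lt i
    have hj := ZMod.val_lt j
    rw [hsucc, hsucc]
    rcases lt_trichotomy i.val j.val with h | h | h
    · rw [hadj' _ _ h hj]; omega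
    · simp only [h, SimpleGraph.irrefl, false_iff]; omega
    · rw [G.adj_comm, hadj' _ _ h hi]; omega
  · intro j
    have h1 : (1 : ZMod (m + 1)).val = 1 := by
      rw [ZMod.val_one_eq_one_mod]; exact Nat.mod_eq_of_lt (by omega)
    rw [hvadj _ (ZMod.val_lt j), zero_add, ← (ZMod.val_injective (m + 1)).eq_iff,
      ← (ZMod.val_injective (m + 1)).eq_iff (b := 1), h1, ZMod.val_zero]

theorem anticonnSet_iff {G : SimpleGraph V} {X : Set V} : AnticonnSet G X ↔ ConnSet Gᶜ X := by
  have : (G.induce X)ᶜ = Gᶜ.induce X := by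
    ext a b
    simp [SimpleGraph.compl_adj, Subtype.ext_iff]
  rw [AnticonnSet, ConnSet, this]

theorem connSet_singleton (G : SimpleGraph V) (a : V) : ConnSet G {a} :=
  ⟨SimpleGraph.Preconnected.of_subsingleton⟩

theorem ConnSet.insert {G : SimpleGraph V} {X : Set V} (hX : ConnSet G X) {a y : V}
    (ha : a ∈ X) (h : G.Adj y a) : ConnSet G (insert y X) := by
  rw [Set.insert_eq]
  exact SimpleGraph.connected_induce_union (connSet_singleton G y).preconnected
    hX.preconnected rfl ha h

theorem ConnSet.union {G : SimpleGraph V} {X Y : Set V} (hX : ConnSet G X) (hY : ConnSet G Y)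
    (h : (X ∩ Y).Nonempty) : ConnSet G (X ∪ Y) :=
  SimpleGraph.induce_union_connected hX.preconnected hY.preconnected h

/-- In a connected set that meets both a property and its negation, some edge crosses. -/
theorem ConnSet.exists_crossing {G : SimpleGraph V} {X : Set V} (hX : ConnSet G X) {p : V → Prop}
    {a b : V} (ha : a ∈ X) (hb : b ∈ X) (hpa : p a) (hpb : ¬ p b) :
    ∃ x ∈ X, ∃ y ∈ X, G.Adj x y ∧ p x ∧ ¬ p y := by
  obtain ⟨q⟩ := hX.preconnected ⟨a, ha⟩ ⟨b, hb⟩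
  obtain ⟨d, -, h1, h2⟩ := q.exists_boundary_dart {x | p x.1} hpa hpb
  exact ⟨_, d.fst.2, _, d.snd.2, d.adj, h1, h2⟩

theorem MixedOn.exists_adj {G : SimpleGraph V} {X : Set V} {v : V} (h : MixedOn G v X)
    (hX : ConnSet G X) : ∃ x ∈ X, ∃ y ∈ X, G.Adj x y ∧ G.Adj v x ∧ ¬ G.Adj v y := by
  obtain ⟨⟨a, ha, hva⟩, ⟨b, hb, hvb⟩⟩ := h
  exact hX.exists_crossing (p := G.Adj v) ha hb hva hvb

theorem MixedOn.exists_not_adj {G : SimpleGraph V} {X : Set V} {v : V} (h : MixedOn G v X)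
    (hX : AnticonnSet G X) :
    ∃ x ∈ X, ∃ y ∈ X, x ≠ y ∧ ¬ G.Adj x y ∧ G.Adj v x ∧ ¬ G.Adj v y := by
  obtain ⟨⟨a, ha, hva⟩, ⟨b, hb, hvb⟩⟩ := h
  obtain ⟨x, hx, y, hy, hxy, h⟩ :=
    (anticonnSet_iff.1 hX).exists_crossing (p := G.Adj v) ha hb hva hvb
  rw [SimpleGraph.compl_adj] at hxy
  exact ⟨x, hx, y, hy, hxy.1, hxy.2, h⟩

theorem CompleteTo.symm {G : SimpleGraph V} {A B : Set V} (h : CompleteTo G A B) :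
    CompleteTo G B A := fun b hb a ha => (h a ha b hb).symm

/-- A vertex mixed on two anticonnected sets complete to each other is the hat of a 4-hole. -/
theorem hasHoleWithHat_of_mixedOn_both {G : SimpleGraph V} {A B : Set V} {v : V}
    (hA : AnticonnSet G A) (hB : AnticonnSet G B) (hAB : CompleteTo G A B)
    (hvA : MixedOn G v A) (hvB : MixedOn G v B) (hvnA : v ∉ A) (hvnB : v ∉ B) :
    HasHoleWithHat G := by
  obtain ⟨a, ha, a', ha', hne, hna, h1, h2⟩ := hvA.exists_not_adj hA
  obtain ⟨b, hb, b', hb', hneb, hnb, h3, h4⟩ := hvB.exists_not_adj hB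
  have e1 := hAB a ha b hb
  have e2 := hAB a ha b' hb'
  have e3 := hAB a' ha' b hb
  have e4 := hAB a' ha' b' hb'
  refine hasHoleWithHat_of_nat (n := 4) le_rfl
    (fun i => match i with | 0 => a | 1 => b | 2 => a' | _ => b') v ?_ ?_ ?_ ?_
  · intro i j hij hj
    interval_cases j <;> interval_cases i <;> simp [hne, hneb, e1.ne, e2.ne, e3.ne', e4.ne]
  · intro i j hij hj
    interval_cases j <;> interval_cases i <;> simp [hna, hnb, e1, e2, e3.symm, e4]
  · intro i hi
    interval_cases i <;> simp <;> rintro rfl <;> contradiction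
  · intro i hi
    interval_cases i <;> simp [h1, h2, h3, h4]

/-- `r 0, …, r k` is a walk inside `X` from a vertex satisfying `p` to one satisfying `q`. -/
def IsLink (G : SimpleGraph V) (X : Set V) (p q : V → Prop) (k : ℕ) (r : ℕ → V) : Prop :=
  (∀ i ≤ k, r i ∈ X) ∧ (∀ i < k, G.Adj (r i) (r (i + 1))) ∧ p (r 0) ∧ q (r k)

theorem ConnSet.exists_isLink {G : SimpleGraph V} {X : Set V} (hX : ConnSet G X)
    {p q : V → Prop} {a b : V} (ha : a ∈ X) (hb : b ∈ X) (hp : p a) (hq : q b) :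
    ∃ k r, IsLink G X p q k r := by
  obtain ⟨W⟩ := hX.preconnected ⟨a, ha⟩ ⟨b, hb⟩
  refine ⟨W.length, fun i => (W.getVert i).1, fun i _ => (W.getVert i).2,
    fun i hi => W.adj_getVert_succ hi, ?_, ?_⟩
  · simpa using hp
  · simpa using hq

/-- In a connected set, a shortest link between two properties is an induced path
whose inner vertices have neither property. -/
theorem ConnSet.exists_induced_link {G : SimpleGraph V} {X : Set V} (hX : ConnSet G X)
    {p q : V → Prop} {a b : V} (ha : a ∈ X) (hb : b ∈ X) (hp : p a) (hq : q b) :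
    ∃ k r, IsLink G X p q k r ∧ (∀ i ≤ k, p (r i) → i = 0) ∧ (∀ i ≤ k, q (r i) → i = k) ∧
      (∀ i j, i < j → j ≤ k → r i ≠ r j) ∧
      (∀ i j, i < j → j ≤ k → G.Adj (r i) (r j) → j = i + 1) := by
  classical
  have hex := hX.exists_isLink ha hb hp hq
  obtain ⟨r, hr⟩ := Nat.find_spec hex
  have hmin : ∀ m < Nat.find hex, ∀ s, ¬ IsLink G X p q m s :=
    fun m hm s hs => Nat.find_min hex hm ⟨s, hs⟩
  generalize Nat.find hex = k at hr hmin
  obtain ⟨hrX, hradj, hrp, hrq⟩ := hr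
  refine ⟨k, r, ⟨hrX, hradj, hrp, hrq⟩, ?_, ?_, ?_, ?_⟩
  · intro i hi hpi
    by_contra h0
    refine hmin (k - i) (by omega) (fun m => r (m + i)) ⟨fun m hm => hrX _ (by omega),
      fun m hm => ?_, by simpa using hpi, ?_⟩
    · have := hradj (m + i) (by omega)
      rwa [show m + i + 1 = m + 1 + i by omega] at this
    · simpa only [Nat.sub_add_cancel hi] using hrq
  · intro i hi hqi
    by_contra h0
    exact hmin i (by omega) r ⟨fun m hm => hrX _ (by omega), fun m hm => hradj _ (by omega),
      hrp, hqi⟩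
  · intro i j hij hj he
    refine hmin (k - (j - i)) (by omega) (fun m => if m ≤ i then r m else r (m + (j - i)))
      ⟨fun m hm => ?_, fun m hm => ?_, by simpa using hrp, ?_⟩
    · dsimp only; split_ifs <;> exact hrX _ (by omega)
    · dsimp only
      rcases lt_trichotomy m i with h | rfl | h
      · rw [if_pos h.le, if_pos (by omega)]; exact hradj _ (by omega)
      · rw [if_pos le_rfl, if_neg (by omega), he, show m + 1 + (j - m) = j + 1 by omega]
        exact hradj _ (by omega)
      · rw [if_neg (by omega), if_neg (by omega), show m + 1 + (j - i) = m + (j - i) + 1 by omega]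
        exact hradj _ (by omega)
    · dsimp only
      split_ifs with h
      · have h1 : k - (j - i) = i := by omega
        have h2 : k = j := by omega
        rw [h1, he, ← h2]; exact hrq
      · rwa [show k - (j - i) + (j - i) = k by omega]
  · intro i j hij hj he
    by_contra hne
    refine hmin (k - (j - i - 1)) (by omega)
      (fun m => if m ≤ i then r m else r (m + (j - i - 1)))
      ⟨fun m hm => ?_, fun m hm => ?_, by simpa using hrp, ?_⟩
    · dsimp only; split_ifs <;> exact hrX _ (by omega)
    · dsimp only
      rcases lt_trichotomy m i with h | rfl | h
      · rw [if_pos h.le, if_pos (by omega)]; exact hradj _ (by omega)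
      · rw [if_pos le_rfl, if_neg (by omega), show m + 1 + (j - m - 1) = j by omega]
        exact he
      · rw [if_neg (by omega), if_neg (by omega),
          show m + 1 + (j - i - 1) = m + (j - i - 1) + 1 by omega]
        exact hradj _ (by omega)
    · dsimp only
      rw [if_neg (by omega), show k - (j - i - 1) + (j - i - 1) = k by omega]
      exact hrq

/-- A pair of connected, anticonnected sets complete to each other, such that no vertex
complete to one of them is mixed on the other. -/
structure IsSaturatedPair (G : SimpleGraph V) (A B : Set V) : Prop where
  conn_left : ConnSet G A
  conn_right : ConnSet G B
  anticonn_left : AnticonnSet G A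
  anticonn_right : AnticonnSet G B
  complete : CompleteTo G A B
  not_mixed_left : ∀ y ∉ A, VertCompleteTo G y B → ¬ MixedOn G y A
  not_mixed_right : ∀ y ∉ B, VertCompleteTo G y A → ¬ MixedOn G y B

theorem IsSaturatedPair.symm {G : SimpleGraph V} {A B : Set V} (h : IsSaturatedPair G A B) :
    IsSaturatedPair G B A :=
  ⟨h.2, h.1, h.4, h.3, h.5.symm, h.7, h.6⟩

theorem IsSaturatedPair.right_subset {G : SimpleGraph V} {A B : Set V}
    (h : IsSaturatedPair G A B) : B ⊆ {v | v ∉ A ∧ ∀ c ∈ A, G.Adj v c} :=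
  fun b hb => ⟨fun hbA => G.irrefl (h.complete b hbA b hb), fun a ha => (h.complete a ha b hb).symm⟩

/-- A connected set avoiding one side `A` of a saturated pair and all vertices complete to `A`,
but with an attachment in `A`, has no attachment in the other side. -/
theorem IsSaturatedPair.anticomplete {G : SimpleGraph V} (hG : HoleWithHatFree G) {A B Y : Set V}
    (h : IsSaturatedPair G A B) (hY : ConnSet G Y)
    (hYX : Y ⊆ (A ∪ {v | v ∉ A ∧ ∀ c ∈ A, G.Adj v c})ᶜ)
    {c y : V} (hc : c ∈ A) (hy : y ∈ Y) (hcy : G.Adj y c) : AnticompleteTo G Y B := by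
  intro u hu b hb hub
  have hYA : ∀ v ∈ Y, v ∉ A := fun v hv hvA => hYX hv (Or.inl hvA)
  have hYB : ∀ v ∈ Y, v ∉ B := fun v hv hvB => hYX hv (Or.inr (h.right_subset hvB))
  have hmix : ∀ v ∈ Y, (∃ a ∈ A, G.Adj v a) → MixedOn G v A := by
    intro v hv hva
    refine ⟨hva, ?_⟩
    by_contra! hcon
    exact hYX hv (Or.inr ⟨hYA v hv, hcon⟩)
  have hanti : ∀ v ∈ Y, (∃ a ∈ A, G.Adj v a) → ¬ ∃ b ∈ B, G.Adj v b := by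
    intro v hv hva hvb
    have hm := hmix v hv hva
    refine hG (hasHoleWithHat_of_mixedOn_both h.anticonn_left h.anticonn_right h.complete hm
      ⟨hvb, ?_⟩ (hYA v hv) (hYB v hv))
    by_contra! hcon
    exact h.not_mixed_left v (hYA v hv) hcon hm
  obtain ⟨k, r, ⟨hrX, hradj, hrp, hrq⟩, hp, hq, hinj, hind⟩ :=
    hY.exists_induced_link (p := fun v => ∃ a ∈ A, G.Adj v a) (q := fun v => ∃ b ∈ B, G.Adj v b)
      hy hu ⟨c, hc, hcy⟩ ⟨b, hb, hub⟩
  have hk : k ≠ 0 := by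
    rintro rfl
    exact hanti _ (hrX 0 le_rfl) hrp hrq
  obtain ⟨a, ha, a', ha', haa, h1, h2⟩ := (hmix _ (hrX 0 (by omega)) hrp).exists_adj h.conn_left
  obtain ⟨d, hd, hkd⟩ := hrq
  have hA0 : ∀ i ≤ k, ∀ x ∈ A, G.Adj (r i) x → i = 0 := fun i hi x hx hx' => hp i hi ⟨x, hx, hx'⟩
  have hBk : ∀ i ≤ k, ∀ x ∈ B, G.Adj (r i) x → i = k := fun i hi x hx hx' => hq i hi ⟨x, hx, hx'⟩
  have hr_a : ∀ i ≤ k, (G.Adj a (r i) ↔ i = 0) := fun i hi =>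
    ⟨fun hh => hA0 i hi a ha hh.symm, fun hh => hh ▸ h1.symm⟩
  have hr_d : ∀ i ≤ k, (G.Adj d (r i) ↔ i = k) := fun i hi =>
    ⟨fun hh => hBk i hi d hd hh.symm, fun hh => hh ▸ hkd.symm⟩
  have hr_a' : ∀ i ≤ k, ¬ G.Adj a' (r i) := fun i hi hh => by
    have := hA0 i hi a' ha' hh.symm
    subst this
    exact h2 hh.symm
  have hr_nA : ∀ i ≤ k, ∀ x ∈ A, x ≠ r i := fun i hi x hx hh => hYA _ (hrX i hi) (hh ▸ hx)
  have hr_nB : ∀ i ≤ k, ∀ x ∈ B, x ≠ r i := fun i hi x hx hh => hYB _ (hrX i hi) (hh ▸ hx)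
  have had := h.complete a ha d hd
  have ha'd := h.complete a' ha' d hd
  refine hG (hasHoleWithHat_of_nat (n := k + 3) (by omega)
    (fun i => match i with | 0 => d | 1 => a | m + 2 => r m) a' ?_ ?_ ?_ ?_)
  · rintro (_ | _ | i) (_ | _ | j) hij hj
    all_goals first | omega | skip
    · exact had.ne'
    · exact hr_nB j (by omega) d hd
    · exact hr_nA j (by omega) a ha
    · exact hinj i j (by omega) (by omega)
  · rintro (_ | _ | i) (_ | _ | j) hij hj
    all_goals first | omega | skip
    · simpa using had.symm
    · exact (hr_d j (by omega)).trans (by omega)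
    · exact (hr_a j (by omega)).trans (by omega)
    · refine ⟨fun hh => ?_, fun hh => ?_⟩
      · have := hind i j (by omega) (by omega) hh
        omega
      · obtain rfl : j = i + 1 := by omega
        exact hradj i (by omega)
  · rintro (_ | _ | i) hi
    · exact ha'd.ne
    · exact haa.ne'
    · exact hr_nA i (by omega) a' ha'
  · rintro (_ | _ | i) hi
    · simpa using ha'd
    · simpa using haa.symm
    · simpa using hr_a' i (by omega)

/-- Connected, anticonnected sets complete to each other can be enlarged to a saturated pair. -/
theorem exists_isSaturatedPair [Finite V] {G : SimpleGraph V} {P Q : Set V} (hP : ConnSet G P)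
    (hQ : ConnSet G Q) (hP' : AnticonnSet G P) (hQ' : AnticonnSet G Q) (hPQ : CompleteTo G P Q) :
    ∃ A B, P ⊆ A ∧ Q ⊆ B ∧ IsSaturatedPair G A B := by
  let S : Set (Set V × Set V) := {X | ConnSet G X.1 ∧ ConnSet G X.2 ∧ AnticonnSet G X.1 ∧
    AnticonnSet G X.2 ∧ CompleteTo G X.1 X.2}
  obtain ⟨⟨A, B⟩, hle, hmax⟩ :=
    S.toFinite.exists_le_maximal (a := (P, Q)) ⟨hP, hQ, hP', hQ', hPQ⟩
  obtain ⟨hA, hB, hA', hB', hAB⟩ := hmax.prop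
  refine ⟨A, B, hle.1, hle.2, hA, hB, hA', hB', hAB, ?_, ?_⟩
  · rintro y hy hyB ⟨⟨a, ha, hya⟩, ⟨a', ha', hya'⟩⟩
    have hmem : (insert y A, B) ∈ S := by
      refine ⟨hA.insert ha hya, hB, anticonnSet_iff.2 ((anticonnSet_iff.1 hA').insert ha' ?_), hB',
        ?_⟩
      · exact (SimpleGraph.compl_adj _ _ _).2 ⟨fun hh => hy (hh ▸ ha'), hya'⟩
      · rintro x (rfl | hx) b hb
        exacts [hyB b hb, hAB x hx b hb]
    exact hy ((hmax.le_of_ge hmem ⟨Set.subset_insert _ _, le_rfl⟩).1 (Set.mem_insert _ _))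
  · rintro y hy hyA ⟨⟨b, hb, hyb⟩, ⟨b', hb', hyb'⟩⟩
    have hmem : (A, insert y B) ∈ S := by
      refine ⟨hA, hB.insert hb hyb, hA', anticonnSet_iff.2 ((anticonnSet_iff.1 hB').insert hb' ?_),
        ?_⟩
      · exact (SimpleGraph.compl_adj _ _ _).2 ⟨fun hh => hy (hh ▸ hb'), hyb'⟩
      · rintro a ha x (rfl | hx)
        exacts [(hyA a ha).symm, hAB a ha x hx]
    exact hy ((hmax.le_of_ge hmem ⟨le_rfl, Set.subset_insert _ _⟩).2 (Set.mem_insert _ _))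

/-- Two sets `Y ⊆ X` and `Y' ⊆ X'` meet if each loses weight less than `ε` and both `X` and `X'`
contain the complement of the union of two sets of weight less than `ε`. -/
theorem inter_nonempty_of_setSum [Fintype V] {w : V → ℝ} {ε : ℝ} (hw : IsWeight w)
    (h4 : 4 * ε ≤ 1) {M N X X' Y Y' : Set V} (hM : setSum w M < ε) (hN : setSum w N < ε)
    (hYX : Y ⊆ X) (hYX' : Y' ⊆ X') (hY : setSum w X - ε < setSum w Y)
    (hY' : setSum w X' - ε < setSum w Y') (hX : (M ∪ N)ᶜ ⊆ X ∩ X') : (Y ∩ Y').Nonempty := by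
  classical
  by_contra hcon
  have hpt : ∀ v, w v ≤ M.indicator w v + N.indicator w v + (X.indicator w v - Y.indicator w v)
      + (X'.indicator w v - Y'.indicator w v) := by
    intro v
    have h0 := hw.1 v
    have h1 : v ∈ Y → v ∈ X := fun h => hYX h
    have h2 : v ∈ Y' → v ∈ X' := fun h => hYX' h
    have h3 : ¬ (v ∈ Y ∧ v ∈ Y') := fun h => hcon ⟨v, h⟩
    have h4 : v ∉ M → v ∉ N → v ∈ X ∧ v ∈ X' := fun hm hn => hX (by simp [hm, hn])
    simp only [Set.indicator_apply]
    by_cases v ∈ M <;> by_cases v ∈ N <;> by_cases v ∈ X <;> by_cases v ∈ X' <;>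
      by_cases v ∈ Y <;> by_cases v ∈ Y' <;> (simp_all; try linarith)
  have hsum := Finset.sum_le_sum (s := Finset.univ) fun v _ => hpt v
  simp only [Finset.sum_add_distrib, Finset.sum_sub_distrib, hw.2] at hsum
  simp only [setSum] at *
  linarith

theorem IsSaturatedPair.isSplit_or [Fintype V] {G : SimpleGraph V} {w : V → ℝ} {ε : ℝ}
    (h4 : 4 * ε ≤ 1) (hw : IsWeight w) (hN : ∀ v, setSum w (G.neighborSet v) < ε)
    (hG : HoleWithHatFree G) {A B : Set V} (h : IsSaturatedPair G A B) (hA : 2 ≤ A.ncard)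
    (hB : 2 ≤ B.ncard) :
    IsSplit G w ε A {v | v ∉ A ∧ ∀ c ∈ A, G.Adj v c} ∨
      IsSplit G w ε B {v | v ∉ B ∧ ∀ c ∈ B, G.Adj v c} := by
  by_contra! ⟨hnA, hnB⟩
  obtain ⟨⟨a, ha⟩⟩ := h.conn_left.nonempty
  obtain ⟨⟨b, hb⟩⟩ := h.conn_right.nonempty
  have key : ∀ {A B : Set V}, IsSaturatedPair G A B → B.Nonempty → 2 ≤ A.ncard →
      ¬ IsSplit G w ε A {v | v ∉ A ∧ ∀ c ∈ A, G.Adj v c} →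
      ∃ Y, IsBigComp G w ε (A ∪ {v | v ∉ A ∧ ∀ c ∈ A, G.Adj v c})ᶜ Y ∧
        ∃ c ∈ A, ∃ y ∈ Y, G.Adj y c := by
    intro A B h hne hA hn
    by_contra! hcon
    refine hn ⟨Set.disjoint_left.2 fun v hv hv' => hv'.1 hv, hA, h.conn_left, h.anticonn_left,
      hne.mono h.right_subset, rfl, ?_⟩
    rintro Y hY c hc ⟨-, y, hy, hcy⟩
    exact hcon Y hY c hc y hy hcy.symm
  obtain ⟨Y, ⟨⟨hYX, hYc, hYm⟩, hYw⟩, c, hc, y, hy, hcy⟩ := key h ⟨b, hb⟩ hA hnA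
  obtain ⟨Y', ⟨⟨hYX', hYc', hYm'⟩, hYw'⟩, c', hc', y', hy', hcy'⟩ := key h.symm ⟨a, ha⟩ hB hnB
  have hYB := h.anticomplete hG hYc hYX hc hy hcy
  have hYA' := h.symm.anticomplete hG hYc' hYX' hc' hy' hcy'
  have hmeet : (Y ∩ Y').Nonempty := by
    refine inter_nonempty_of_setSum hw h4 (hN a) (hN b) hYX hYX' hYw hYw' ?_
    intro v hv
    have hva : ¬ G.Adj a v := fun hh => hv (Or.inl hh)
    have hvb : ¬ G.Adj b v := fun hh => hv (Or.inr hh)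
    constructor
    · rintro (hvA | hvA)
      exacts [hvb (h.complete v hvA b hb).symm, hva (hvA.2 a ha).symm]
    · rintro (hvB | hvB)
      exacts [hva (h.complete a ha v hvB), hvb (hvB.2 b hb).symm]
  have hsub : Y' ∪ Y ⊆ (B ∪ {v | v ∉ B ∧ ∀ c ∈ B, G.Adj v c})ᶜ := by
    refine Set.union_subset hYX' ?_
    rintro v hv (hvB | hvB)
    · exact hYX hv (Or.inr (h.right_subset hvB))
    · exact hYB v hv b hb (hvB.2 b hb)
  have heq := hYm' _ Set.subset_union_left hsub (hYc'.union hYc (by rwa [Set.inter_comm]))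
  exact hYA' y (heq ▸ Or.inr hy) c hc hcy

theorem connSet_of_path {G : SimpleGraph V} {a b c d : V} (h1 : G.Adj a b) (h2 : G.Adj b c)
    (h3 : G.Adj c d) : ConnSet G {a, b, c, d} :=
  (((connSet_singleton G d).insert rfl h3).insert (by simp) h2).insert (by simp) h1

theorem anticonnSet_of_path {G : SimpleGraph V} {a b c d : V} (h1 : Gᶜ.Adj a c) (h2 : Gᶜ.Adj a d)
    (h3 : Gᶜ.Adj b d) : AnticonnSet G {a, b, c, d} := by
  have : ({a, b, c, d} : Set V) = {c, a, d, b} := by ext; simp; tauto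
  rw [anticonnSet_iff, this]
  exact connSet_of_path h1.symm h2 h3.symm

theorem statement_10 {V : Type} [Fintype V] (G : SimpleGraph V) (w : V → ℝ) (ε : ℝ)
    (hε : 0 < ε) (h5 : 5 * ε ≤ 1) (hw : IsWeight w) (hcoh : Coherent G w ε)
    (hG : HoleWithHatFree G) (F : forcer ↪g G) :
    ∃ C D : Set V, IsSplit G w ε C D ∧
      ConstituentPathIn (fun i => F i) C ∧ ConstituentPathIn (fun i => F i) D := by
  have hadj : ∀ i j, G.Adj (F i) (F j) ↔ i ≠ j ∧ (forcerRel i j ∨ forcerRel j i) := fun i j => by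
    rw [F.map_adj_iff, forcer, SimpleGraph.fromRel_adj]
  have hnadj : ∀ i j, Gᶜ.Adj (F i) (F j) ↔ i ≠ j ∧ ¬ (forcerRel i j ∨ forcerRel j i) :=
    fun i j => by
      rw [SimpleGraph.compl_adj, hadj, F.injective.ne_iff]
      tauto
  have hPQ : CompleteTo G {F 0, F 1, F 2, F 3} {F 4, F 5, F 6, F 7} := by
    rintro _ (rfl | rfl | rfl | rfl) _ (rfl | rfl | rfl | rfl) <;> rw [hadj] <;>
      simp [forcerRel]
  obtain ⟨A, B, hPA, hQB, h⟩ := exists_isSaturatedPair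
    (connSet_of_path (G := G) (a := F 0) (b := F 1) (c := F 2) (d := F 3)
      (by rw [hadj]; simp [forcerRel]) (by rw [hadj]; simp [forcerRel])
      (by rw [hadj]; simp [forcerRel]))
    (connSet_of_path (G := G) (a := F 4) (b := F 5) (c := F 6) (d := F 7)
      (by rw [hadj]; simp [forcerRel]) (by rw [hadj]; simp [forcerRel])
      (by rw [hadj]; simp [forcerRel]))
    (anticonnSet_of_path
      (by rw [hnadj]; simp [forcerRel]) (by rw [hnadj]; simp [forcerRel])
      (by rw [hnadj]; simp [forcerRel]))
    (anticonnSet_of_path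
      (by rw [hnadj]; simp [forcerRel]) (by rw [hnadj]; simp [forcerRel])
      (by rw [hnadj]; simp [forcerRel])) hPQ
  have hA : ∀ i : Fin 8, i.val < 4 → F i ∈ A := by
    intro i hi
    apply hPA
    fin_cases i <;> simp at hi ⊢
  have hB : ∀ i : Fin 8, 4 ≤ i.val → F i ∈ B := by
    intro i hi
    apply hQB
    fin_cases i <;> simp at hi ⊢
  have hcard : ∀ {S : Set V} {i j : Fin 8}, i ≠ j → F i ∈ S → F j ∈ S → 2 ≤ S.ncard :=
    fun hij hi hj => (Set.one_lt_ncard (Set.toFinite _)).2 ⟨_, hi, _, hj, F.injective.ne hij⟩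
  rcases h.isSplit_or (by linarith) hw hcoh.2.1 hG
    (hcard (i := 0) (j := 1) (by decide) (hA _ (by decide)) (hA _ (by decide)))
    (hcard (i := 4) (j := 5) (by decide) (hB _ (by decide)) (hB _ (by decide))) with hs | hs
  · exact ⟨_, _, hs, Or.inl hA, Or.inr fun i hi => h.right_subset (hB i hi)⟩
  · exact ⟨_, _, hs, Or.inr hB, Or.inl fun i hi => h.symm.right_subset (hA i hi)⟩

end EHhat
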